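/- arXiv:2310.00806 — 5 statements merged into one kernel-verified Lean document; each statement's English description precedes it below -/
import Mathlib

section
/- Bounding AIR under posterior sampling by the Thompson-sampling objective: assume f_M(π) ∈ [0,1] for all M ∈ 𝓜 and π ∈ Π. Then for every η ∈ (0, 1/3], every q ∈ Δ(Π) with all coordinates positive, and every ν ∈ Δ(𝓜×Π): AIR_{q,η}(q,ν) ≤ Σ_{M,π*,π} ν(M,π*)·ν_{π*}(π)·( f_M(π*) − f_M(π) ) − (1/(2η))·Σ_{π*,π : ν_{π*}(π*)>0} ν_{π*}(π*)·ν_{π*}(π)·D_H²( ν_{o|π*,π}, ν_{o|π} ) + 2η. -/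
open Finset

/-- The probability simplex on a finite set. -/
def IsProb {S : Type*} [Fintype S] (p : S → ℝ) : Prop :=
  (∀ x, 0 ≤ p x) ∧ ∑ x, p x = 1

/-- KL divergence between probability vectors on a finite set, real-valued formula
`Σ_x p(x)·log(p(x)/q(x))`; the convention `0·log(0/y) = 0` is automatic since
`0 * _ = 0` in `ℝ`. -/
noncomputable def KLr {S : Type*} [Fintype S] (p q : S → ℝ) : ℝ :=
  ∑ x, p x * Real.log (p x / q x)

/-- Marginal distribution of the optimal decision `π*` under a belief `ν ∈ Δ(𝓜×Π)`. -/
noncomputable def margPi {M P : Type*} [Fintype M] [Fintype P] (ν : M × P → ℝ) : P → ℝ :=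
  fun π' => ∑ m, ν (m, π')

/-- `m_ν(π,o) = Σ_{M,π'} ν(M,π')·[M(π)](o)`, the probability of observing `o`
after playing `π`, under belief `ν` with observation kernels `Mo`. -/
noncomputable def mObs {M P O : Type*} [Fintype M] [Fintype P] [Fintype O]
    (Mo : M → P → O → ℝ) (ν : M × P → ℝ) (π : P) (o : O) : ℝ :=
  ∑ x : M × P, ν x * Mo x.1 π o

/-- Marginal posterior of `π*` given `(π,o)` under belief `ν`:
`ν_{π*|π,o}(π̄) = Σ_M ν(M,π̄)·[M(π)](o) / m_ν(π,o)` (Lean's `x/0 = 0` convention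
harmlessly handles the zero-probability case, whose summands carry zero weight). -/
noncomputable def post {M P O : Type*} [Fintype M] [Fintype P] [Fintype O]
    (Mo : M → P → O → ℝ) (ν : M × P → ℝ) (π : P) (o : O) : P → ℝ :=
  fun π' => (∑ m, ν (m, π') * Mo m π o) / mObs Mo ν π o

/-- Algorithmic Information Ratio
`AIR_{q,η}(p,ν) = Σ_{M,π̄,π,o} ν(M,π̄)·p(π)·[M(π)](o)·(f_M(π̄) − f_M(π) − (1/η)·KL(ν_{π*|π,o},q))`. -/
noncomputable def AIR {M P O : Type*} [Fintype M] [Fintype P] [Fintype O]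
    (Mo : M → P → O → ℝ) (f : M → P → ℝ)
    (q p : P → ℝ) (η : ℝ) (ν : M × P → ℝ) : ℝ :=
  ∑ x : M × P, ∑ π, ∑ o, ν x * p π * Mo x.1 π o *
    (f x.1 x.2 - f x.1 π - (1 / η) * KLr (post Mo ν π o) q)

/-- Squared Hellinger distance between probability vectors on a finite set. -/
noncomputable def Hsq {S : Type*} [Fintype S] (p q : S → ℝ) : ℝ :=
  ∑ x, (Real.sqrt (p x) - Real.sqrt (q x)) ^ 2

/-- Conditional observation law `ν_{o|π*,π}(o) = Σ_M ν(M,π*)·[M(π)](o) / ν_{π*}(π*)`. -/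
noncomputable def obsCond {M P O : Type*} [Fintype M] [Fintype P] [Fintype O]
    (Mo : M → P → O → ℝ) (ν : M × P → ℝ) (πs π : P) : O → ℝ :=
  fun o => (∑ m, ν (m, πs) * Mo m π o) / margPi ν πs

/-- Marginal observation law `ν_{o|π}(o) = Σ_{M,π'} ν(M,π')·[M(π)](o)`. -/
noncomputable def obsMarg {M P O : Type*} [Fintype M] [Fintype P] [Fintype O]
    (Mo : M → P → O → ℝ) (ν : M × P → ℝ) (π : P) : O → ℝ :=
  fun o => ∑ x : M × P, ν x * Mo x.1 π o

section SimplexInequalities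

variable {S T : Type*} [Fintype S] [Fintype T]

theorem sub_le_mul_log_div {x y : ℝ} (hx : 0 < x) (hy : 0 < y) :
    x - y + (√x - √y) ^ 2 ≤ x * Real.log (x / y) := by
  have hsx := Real.sqrt_pos.2 hx
  have hsy := Real.sqrt_pos.2 hy
  have hlog : Real.log (x / y) = -2 * Real.log (√y / √x) := by
    rw [Real.log_div hx.ne' hy.ne', Real.log_div hsy.ne' hsx.ne', Real.log_sqrt hx.le,
      Real.log_sqrt hy.le]
    ring
  have hle := Real.log_le_sub_one_of_pos (div_pos hsy hsx)
  have hmul : x * (√y / √x) = √x * √y := by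
    field_simp
    rw [Real.sq_sqrt hx.le]
  rw [hlog]
  nlinarith [mul_le_mul_of_nonneg_left hle hx.le, Real.sq_sqrt hx.le, Real.sq_sqrt hy.le]

theorem mul_sqrt_div_sub_sqrt_sq {j m r : ℝ} (hj : 0 ≤ j) (hr : 0 < r) :
    r * (√(j / r) - √m) ^ 2 = (√j - √(m * r)) ^ 2 := by
  rw [Real.sqrt_div hj, Real.sqrt_mul' m hr.le]
  have hs := Real.sqrt_pos.2 hr
  have hsq := Real.sq_sqrt hr.le
  field_simp
  rw [hsq]

theorem joint_mul_log_lower_bound {j m r q : ℝ} (hj : 0 ≤ j) (hjm : j ≤ m) (hjr : j ≤ r)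
    (hq : 0 < q) :
    j * Real.log (r / q) + (j - m * r) + r * (√(j / r) - √m) ^ 2 ≤
      m * (j / m * Real.log (j / m / q)) := by
  rcases hj.eq_or_lt with rfl | hj
  · simp [Real.sq_sqrt hjm]
    linarith
  · have hm := hj.trans_le hjm
    have hr := hj.trans_le hjr
    have hmul : m * (j / m * Real.log (j / m / q)) = j * Real.log (j / m / q) := by
      field_simp
    have hlog : Real.log (j / m / q) = Real.log (r / q) + Real.log (j / (m * r)) := by
      rw [← Real.log_mul (by positivity) (by positivity)]
      congr 1
      field_simp
    rw [hmul, hlog, mul_sqrt_div_sub_sqrt_sq hj.le hr]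
    linarith [sub_le_mul_log_div hj (mul_pos hm hr)]

theorem KLr_add_hellinger_le_expected_posterior_KLr (J : S → T → ℝ) (hJ : ∀ s t, 0 ≤ J s t)
    (r q : S → ℝ) (m : T → ℝ) (hr : ∀ s, ∑ t, J s t = r s) (hm : ∀ t, ∑ s, J s t = m t)
    (hsum : ∑ s, r s = 1) (hq : ∀ s, 0 < q s) :
    KLr r q + ∑ s, r s * Hsq (fun t => J s t / r s) m ≤
      ∑ t, m t * KLr (fun s => J s t / m t) q := by
  have hm1 : ∑ t, m t = 1 := by
    simp_rw [← hm]
    rw [sum_comm]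
    simp_rw [hr, hsum]
  have hkl : KLr r q = ∑ s, ∑ t, J s t * Real.log (r s / q s) := by
    simp_rw [← sum_mul, hr, KLr]
  have hzero : ∑ s, ∑ t, (J s t - m t * r s) = 0 := by
    simp_rw [sum_sub_distrib, ← sum_mul, hr, hm1, one_mul, sub_self]
  have hhel : ∑ s, r s * Hsq (fun t => J s t / r s) m =
      ∑ s, ∑ t, r s * (√(J s t / r s) - √(m t)) ^ 2 := by
    simp_rw [Hsq, mul_sum]
  have hpost : ∑ t, m t * KLr (fun s => J s t / m t) q =
      ∑ s, ∑ t, m t * (J s t / m t * Real.log (J s t / m t / q s)) := by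
    simp_rw [KLr, mul_sum]
    rw [sum_comm]
  rw [hpost, ← add_zero (KLr r q), ← hzero, hkl, hhel, ← sum_add_distrib, ← sum_add_distrib]
  refine sum_le_sum fun s _ => ?_
  rw [← sum_add_distrib, ← sum_add_distrib]
  refine sum_le_sum fun t _ => joint_mul_log_lower_bound (hJ s t) ?_ ?_ (hq s)
  · exact hm t ▸ single_le_sum (f := fun s => J s t) (fun s _ => hJ s t) (mem_univ s)
  · exact hr s ▸ single_le_sum (fun t _ => hJ s t) (mem_univ t)

theorem Hsq_nonneg (p q : S → ℝ) : 0 ≤ Hsq p q :=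
  sum_nonneg fun _ _ => sq_nonneg _

theorem Hsq_le_two {p q : S → ℝ} (hp : IsProb p) (hq : IsProb q) : Hsq p q ≤ 2 := by
  calc Hsq p q ≤ ∑ x, (p x + q x) := by
        refine sum_le_sum fun x _ => ?_
        nlinarith [Real.sq_sqrt (hp.1 x), Real.sq_sqrt (hq.1 x),
          mul_nonneg (Real.sqrt_nonneg (p x)) (Real.sqrt_nonneg (q x))]
    _ = 2 := by rw [sum_add_distrib, hp.2, hq.2]; norm_num

theorem exp_le_of_nonpos {c : ℝ} (hc : c ≤ 0) : Real.exp c ≤ 1 + c + c ^ 2 / 2 := by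
  have h := Real.quadratic_le_exp_of_nonneg (neg_nonneg.2 hc)
  have hmul : Real.exp c * Real.exp (-c) = 1 := by rw [← Real.exp_add]; simp
  have hbound := mul_le_mul_of_nonneg_left h (Real.exp_pos c).le
  nlinarith [sq_nonneg (c + 1), mul_nonneg (Real.exp_pos c).le (sq_nonneg (c ^ 2))]

/-- A linearised Donsker–Varadhan inequality. -/
theorem sum_mul_le_KLr_add_sum_mul_exp {r q : S → ℝ} (hr : IsProb r) (hq : ∀ s, 0 < q s)
    (h : S → ℝ) :
    ∑ s, r s * h s ≤ KLr r q + ∑ s, q s * Real.exp (h s) - 1 := by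
  rw [KLr, ← hr.2, ← sum_add_distrib, ← sum_sub_distrib]
  refine sum_le_sum fun s _ => ?_
  rcases (hr.1 s).eq_or_lt with h0 | hpos
  · simp [← h0, (mul_pos (hq s) (Real.exp_pos _)).le]
  · have hle := Real.log_le_sub_one_of_pos
      (div_pos (mul_pos (hq s) (Real.exp_pos (h s))) hpos)
    rw [Real.log_div (mul_pos (hq s) (Real.exp_pos _)).ne' hpos.ne',
      Real.log_mul (hq s).ne' (Real.exp_pos _).ne', Real.log_exp] at hle
    have hmul := mul_le_mul_of_nonneg_left hle hpos.le
    have hcancel : r s * (q s * Real.exp (h s) / r s - 1) = q s * Real.exp (h s) - r s := by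
      field_simp
    rw [hcancel] at hmul
    rw [Real.log_div hpos.ne' (hq s).ne']
    linarith

theorem exp_add_half_le {c x : ℝ} (hc : c ≤ 0) (hx0 : 0 ≤ x) (hx2 : x ≤ 2) :
    Real.exp (c + x / 2) ≤ 1 + c + c ^ 2 / 2 + x := by
  have hconv : Real.exp (x / 2) ≤ 1 + x := by
    have h := convexOn_exp.2 (Set.mem_univ 0) (Set.mem_univ 1)
      (show (0 : ℝ) ≤ 1 - x / 2 by linarith) (show 0 ≤ x / 2 by linarith) (by ring)
    simp only [smul_eq_mul, mul_zero, mul_one, zero_add, Real.exp_zero] at h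
    nlinarith [Real.exp_one_lt_d9]
  have hone := Real.exp_le_one_iff.2 hc
  rw [Real.exp_add]
  nlinarith [mul_le_mul_of_nonneg_left hconv (Real.exp_pos c).le, exp_le_of_nonpos hc]

theorem change_of_measure_le {r q g X : S → ℝ} {η : ℝ} (hr : IsProb r) (hq : IsProb q)
    (hqpos : ∀ s, 0 < q s) (hη : 0 ≤ η) (hg0 : ∀ s, 0 ≤ g s) (hg1 : ∀ s, g s ≤ 1)
    (hX0 : ∀ s, 0 ≤ X s) (hX2 : ∀ s, X s ≤ 2) :
    η * ∑ s, r s * g s + (∑ s, r s * X s) / 2 ≤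
      KLr r q + η * ∑ s, q s * g s + ∑ s, q s * X s + η ^ 2 / 2 := by
  have hdv := sum_mul_le_KLr_add_sum_mul_exp hr hqpos (fun s => η * (g s - 1) + X s / 2)
  have hexp : ∑ s, q s * Real.exp (η * (g s - 1) + X s / 2) ≤
      ∑ s, q s * (1 + η * (g s - 1) + η ^ 2 / 2 + X s) := by
    refine sum_le_sum fun s _ => mul_le_mul_of_nonneg_left ?_ (hqpos s).le
    refine (exp_add_half_le (mul_nonpos_of_nonneg_of_nonpos hη (by linarith [hg1 s]))
      (hX0 s) (hX2 s)).trans ?_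
    have : (g s - 1) ^ 2 ≤ 1 := by nlinarith [hg0 s, hg1 s]
    nlinarith [mul_le_mul_of_nonneg_left this (sq_nonneg η)]
  have hleft : ∑ s, r s * (η * (g s - 1) + X s / 2) =
      η * ∑ s, r s * g s - η * ∑ s, r s + (∑ s, r s * X s) / 2 := by
    rw [mul_sum, mul_sum, sum_div, ← sum_sub_distrib, ← sum_add_distrib]
    exact sum_congr rfl fun s _ => by ring
  have hright : ∑ s, q s * (1 + η * (g s - 1) + η ^ 2 / 2 + X s) =
      (1 - η + η ^ 2 / 2) * ∑ s, q s + η * ∑ s, q s * g s + ∑ s, q s * X s := by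
    rw [mul_sum, mul_sum, ← sum_add_distrib, ← sum_add_distrib]
    exact sum_congr rfl fun s _ => by ring
  rw [hr.2] at hleft
  rw [hq.2] at hright
  linarith

end SimplexInequalities

section Beliefs

variable {M P O : Type*} [Fintype M] [Fintype P] [Fintype O]

theorem margPi_isProb {ν : M × P → ℝ} (hν : IsProb ν) : IsProb (margPi ν) := by
  refine ⟨fun _ => sum_nonneg fun _ _ => hν.1 _, ?_⟩
  rw [← hν.2, Fintype.sum_prod_type, sum_comm]
  rfl

theorem sum_joint_obs {Mo : M → P → O → ℝ} (hMo : ∀ m π, IsProb (Mo m π)) (ν : M × P → ℝ)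
    (πs π : P) : ∑ o, ∑ m, ν (m, πs) * Mo m π o = margPi ν πs := by
  rw [sum_comm]
  simp_rw [← mul_sum, (hMo _ _).2, mul_one, margPi]

theorem sum_joint_decision (Mo : M → P → O → ℝ) (ν : M × P → ℝ) (π : P) (o : O) :
    ∑ πs, ∑ m, ν (m, πs) * Mo m π o = mObs Mo ν π o := by
  rw [mObs, Fintype.sum_prod_type, sum_comm]

theorem joint_nonneg {Mo : M → P → O → ℝ} (hMo : ∀ m π, IsProb (Mo m π)) {ν : M × P → ℝ}
    (hν : IsProb ν) (πs π : P) (o : O) : 0 ≤ ∑ m, ν (m, πs) * Mo m π o :=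
  sum_nonneg fun m _ => mul_nonneg (hν.1 _) ((hMo m π).1 o)

theorem obsMarg_isProb {Mo : M → P → O → ℝ} (hMo : ∀ m π, IsProb (Mo m π)) {ν : M × P → ℝ}
    (hν : IsProb ν) (π : P) : IsProb (obsMarg Mo ν π) := by
  refine ⟨fun o => sum_nonneg fun x _ => mul_nonneg (hν.1 _) ((hMo _ _).1 o), ?_⟩
  simp_rw [obsMarg]
  rw [sum_comm]
  simp_rw [← mul_sum, (hMo _ _).2, mul_one, hν.2]

theorem obsCond_isProb {Mo : M → P → O → ℝ} (hMo : ∀ m π, IsProb (Mo m π)) {ν : M × P → ℝ}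
    (hν : IsProb ν) {πs : P} (hπs : 0 < margPi ν πs) (π : P) : IsProb (obsCond Mo ν πs π) := by
  refine ⟨fun o => div_nonneg (joint_nonneg hMo hν πs π o) hπs.le, ?_⟩
  simp_rw [obsCond]
  rw [← sum_div, sum_joint_obs hMo, div_self hπs.ne']

theorem expected_Hsq_nonneg (Mo : M → P → O → ℝ) {ν : M × P → ℝ} (hν : IsProb ν) (π : P) :
    0 ≤ ∑ πs, margPi ν πs * Hsq (obsCond Mo ν πs π) (obsMarg Mo ν π) :=
  sum_nonneg fun πs _ => mul_nonneg ((margPi_isProb hν).1 πs) (Hsq_nonneg _ _)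

theorem expected_Hsq_le_two {Mo : M → P → O → ℝ} (hMo : ∀ m π, IsProb (Mo m π))
    {ν : M × P → ℝ} (hν : IsProb ν) (π : P) :
    ∑ πs, margPi ν πs * Hsq (obsCond Mo ν πs π) (obsMarg Mo ν π) ≤ 2 := by
  calc _ ≤ ∑ πs, margPi ν πs * 2 := by
        refine sum_le_sum fun πs _ => ?_
        rcases ((margPi_isProb hν).1 πs).eq_or_lt with h0 | hpos
        · simp [← h0]
        · exact mul_le_mul_of_nonneg_left
            (Hsq_le_two (obsCond_isProb hMo hν hpos π) (obsMarg_isProb hMo hν π)) hpos.le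
    _ = 2 := by rw [← sum_mul, (margPi_isProb hν).2, one_mul]

theorem KLr_add_expected_Hsq_le {Mo : M → P → O → ℝ} (hMo : ∀ m π, IsProb (Mo m π))
    {ν : M × P → ℝ} (hν : IsProb ν) {q : P → ℝ} (hq : ∀ π, 0 < q π) (π : P) :
    KLr (margPi ν) q + ∑ πs, margPi ν πs * Hsq (obsCond Mo ν πs π) (obsMarg Mo ν π) ≤
      ∑ o, mObs Mo ν π o * KLr (post Mo ν π o) q :=
  KLr_add_hellinger_le_expected_posterior_KLr (fun πs o => ∑ m, ν (m, πs) * Mo m π o)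
    (fun πs o => joint_nonneg hMo hν πs π o) (margPi ν) q (mObs Mo ν π)
    (fun πs => sum_joint_obs hMo ν πs π) (sum_joint_decision Mo ν π) (margPi_isProb hν).2 hq

theorem sum_mul_regret_eq (ν : M × P → ℝ) (f : M → P → ℝ) {p : P → ℝ}
    (hp : IsProb p) :
    ∑ x : M × P, ∑ π, ν x * p π * (f x.1 x.2 - f x.1 π) =
      ∑ x, ν x * f x.1 x.2 - ∑ π, p π * ∑ x, ν x * f x.1 π := by
  have hswap : ∑ π, p π * ∑ x, ν x * f x.1 π = ∑ x, ∑ π, ν x * p π * f x.1 π := by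
    simp_rw [mul_sum]
    rw [sum_comm]
    exact sum_congr rfl fun x _ => sum_congr rfl fun π _ => by ring
  rw [hswap, ← sum_sub_distrib]
  refine sum_congr rfl fun x _ => ?_
  simp_rw [mul_sub, sum_sub_distrib, ← sum_mul, ← mul_sum, hp.2, mul_one]

theorem AIR_eq {Mo : M → P → O → ℝ} (hMo : ∀ m π, IsProb (Mo m π)) (f : M → P → ℝ)
    (q p : P → ℝ) (η : ℝ) (ν : M × P → ℝ) :
    AIR Mo f q p η ν =
      ∑ x : M × P, ∑ π, ν x * p π * (f x.1 x.2 - f x.1 π) -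
        (1 / η) * ∑ π, p π * ∑ o, mObs Mo ν π o * KLr (post Mo ν π o) q := by
  have hkl : ∑ π, p π * ∑ o, mObs Mo ν π o * KLr (post Mo ν π o) q =
      ∑ x, ∑ π, ∑ o, ν x * p π * Mo x.1 π o * KLr (post Mo ν π o) q := by
    rw [sum_comm]
    refine sum_congr rfl fun π _ => ?_
    rw [sum_comm, mul_sum]
    refine sum_congr rfl fun o _ => ?_
    rw [mObs, sum_mul, mul_sum]
    exact sum_congr rfl fun x _ => by ring
  rw [hkl, AIR, mul_sum, ← sum_sub_distrib]
  refine sum_congr rfl fun x _ => ?_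
  rw [mul_sum, ← sum_sub_distrib]
  refine sum_congr rfl fun π _ => ?_
  have hone : ν x * p π * (f x.1 x.2 - f x.1 π) =
      ∑ o, ν x * p π * Mo x.1 π o * (f x.1 x.2 - f x.1 π) := by
    rw [← sum_mul, ← mul_sum, (hMo _ _).2, mul_one]
  rw [hone, mul_sum, ← sum_sub_distrib]
  exact sum_congr rfl fun o _ => by ring

end Beliefs

/-- Bounding AIR under posterior sampling by the Thompson-sampling objective:
for rewards in `[0,1]` and `η ∈ (0,1/3]`,
`AIR_{q,η}(q,ν) ≤ E_{ν,ν_{π*}}[f_M(π*) − f_M(π)]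
  − (1/2η)·E[D_H²(ν_{o|π*,π}, ν_{o|π})] + 2η`. -/
theorem air_posterior_sampling_le_ts
    {M P O : Type*} [Fintype M] [Nonempty M] [Fintype P] [Nonempty P]
    [Fintype O] [Nonempty O]
    (Mo : M → P → O → ℝ) (hMo : ∀ m π, IsProb (Mo m π))
    (f : M → P → ℝ) (hf : ∀ m π, 0 ≤ f m π ∧ f m π ≤ 1)
    (η : ℝ) (hη : 0 < η) (hη3 : η ≤ 1 / 3)
    (q : P → ℝ) (hq : IsProb q) (hqpos : ∀ π, 0 < q π)
    (ν : M × P → ℝ) (hν : IsProb ν) :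
    AIR Mo f q q η ν ≤
      (∑ x : M × P, ∑ π, ν x * margPi ν π * (f x.1 x.2 - f x.1 π))
        - (1 / (2 * η)) * (∑ πs, ∑ π, if 0 < margPi ν πs then
            margPi ν πs * margPi ν π * Hsq (obsCond Mo ν πs π) (obsMarg Mo ν π) else 0)
        + 2 * η := by
  set X : P → ℝ := fun π =>
    ∑ πs, margPi ν πs * Hsq (obsCond Mo ν πs π) (obsMarg Mo ν π) with hX
  set g : P → ℝ := fun π => ∑ x : M × P, ν x * f x.1 π with hg
  have hρ := margPi_isProb hν
  have hhel : (∑ πs, ∑ π, if 0 < margPi ν πs then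
      margPi ν πs * margPi ν π * Hsq (obsCond Mo ν πs π) (obsMarg Mo ν π) else 0) =
      ∑ π, margPi ν π * X π := by
    rw [sum_comm]
    refine sum_congr rfl fun π _ => ?_
    rw [hX, mul_sum]
    refine sum_congr rfl fun πs _ => ?_
    split_ifs with hpos
    · ring
    · simp [le_antisymm (not_lt.1 hpos) (hρ.1 πs)]
  have hg0 : ∀ π, 0 ≤ g π := fun π =>
    sum_nonneg fun x _ => mul_nonneg (hν.1 x) (hf x.1 π).1
  have hg1 : ∀ π, g π ≤ 1 := fun π =>
    (sum_le_sum fun x _ => mul_le_of_le_one_right (hν.1 x) (hf x.1 π).2).trans_eq hν.2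
  have hcm := change_of_measure_le hρ hq hqpos hη.le hg0 hg1
    (expected_Hsq_nonneg Mo hν) (expected_Hsq_le_two hMo hν)
  have hinfo : KLr (margPi ν) q + ∑ π, q π * X π ≤
      ∑ π, q π * ∑ o, mObs Mo ν π o * KLr (post Mo ν π o) q := by
    calc _ = ∑ π, q π * (KLr (margPi ν) q + X π) := by
          simp_rw [mul_add, sum_add_distrib, ← sum_mul, hq.2, one_mul]
      _ ≤ _ := sum_le_sum fun π _ => mul_le_mul_of_nonneg_left
          (KLr_add_expected_Hsq_le hMo hν hqpos π) (hqpos π).le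
  rw [AIR_eq hMo, sum_mul_regret_eq ν f hq, sum_mul_regret_eq ν f hρ, hhel]
  change _ - ∑ π, q π * g π - _ ≤ _ - ∑ π, margPi ν π * g π - _ + _
  change η * ∑ π, margPi ν π * g π + (∑ π, margPi ν π * X π) / 2 ≤
    KLr (margPi ν) q + η * ∑ π, q π * g π + ∑ π, q π * X π + η ^ 2 / 2 at hcm
  have hdiv := div_le_div_of_nonneg_right (hcm.trans
    (show _ ≤ η * ∑ π, q π * g π +
      ∑ π, q π * ∑ o, mObs Mo ν π o * KLr (post Mo ν π o) q + η ^ 2 / 2 by linarith)) hη.le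
  have hl : (η * ∑ π, margPi ν π * g π + (∑ π, margPi ν π * X π) / 2) / η =
      ∑ π, margPi ν π * g π + 1 / (2 * η) * ∑ π, margPi ν π * X π := by
    field_simp
  have hr : (η * ∑ π, q π * g π +
      ∑ π, q π * ∑ o, mObs Mo ν π o * KLr (post Mo ν π o) q + η ^ 2 / 2) / η =
      ∑ π, q π * g π +
        1 / η * ∑ π, q π * ∑ o, mObs Mo ν π o * KLr (post Mo ν π o) q + η / 2 := by
    field_simp
  rw [hl, hr] at hdiv
  linarith
end

section
/- Information ratio of Thompson sampling for K-armed bandits (squared Hellinger form): for every belief ν ∈ Δ(𝓜×Π), ( Σ_{M,π*} ν(M,π*)·f_M(π*) − Σ_{M,π*,π} ν(M,π*)·ν_{π*}(π)·f_M(π) )² ≤ 4K · Σ_{π*,π : ν_{π*}(π*)>0} ν_{π*}(π*)·ν_{π*}(π)·D_H²( ν_{o|π*,π}, ν_{o|π} ). -/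
open Finset

/-- The difference of the means of two distributions with values in `[0,1]` is controlled by
their squared Hellinger distance. -/
lemma sq_mean_sub_le_Hsq {S : Type*} [Fintype S] {p q r : S → ℝ}
    (hp : IsProb p) (hq : IsProb q) (hr : ∀ x, 0 ≤ r x ∧ r x ≤ 1) :
    (∑ x, r x * p x - ∑ x, r x * q x) ^ 2 ≤ 4 * Hsq p q := by
  have hfactor : ∑ x, r x * p x - ∑ x, r x * q x
      = ∑ x, (√(p x) - √(q x)) * (r x * (√(p x) + √(q x))) := by
    rw [← sum_sub_distrib]
    refine sum_congr rfl fun x _ => ?_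
    linear_combination r x * (Real.sq_sqrt (hq.1 x)) - r x * (Real.sq_sqrt (hp.1 x))
  have hbound : ∑ x, (r x * (√(p x) + √(q x))) ^ 2 ≤ 4 := by
    calc ∑ x, (r x * (√(p x) + √(q x))) ^ 2 ≤ ∑ x, (2 * p x + 2 * q x) := by
          refine sum_le_sum fun x _ => ?_
          have h1 : r x * (√(p x) + √(q x)) ≤ √(p x) + √(q x) :=
            mul_le_of_le_one_left (by positivity) (hr x).2
          have h0 : 0 ≤ r x * (√(p x) + √(q x)) := mul_nonneg (hr x).1 (by positivity)
          have h2 := pow_le_pow_left₀ h0 h1 2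
          linarith [sq_nonneg (√(p x) - √(q x)), Real.sq_sqrt (hq.1 x), Real.sq_sqrt (hp.1 x)]
      _ = 4 := by
          rw [sum_add_distrib, ← mul_sum, ← mul_sum, hp.2, hq.2]
          norm_num
  have hnonneg : 0 ≤ Hsq p q := sum_nonneg fun x _ => sq_nonneg _
  rw [hfactor]
  refine (sum_mul_sq_le_sq_mul_sq _ _ _).trans ?_
  rw [mul_comm 4]
  exact mul_le_mul_of_nonneg_left hbound hnonneg

lemma margPi_nonneg {M P : Type*} [Fintype M] [Fintype P] {ν : M × P → ℝ}
    (hν : IsProb ν) (a : P) : 0 ≤ margPi ν a :=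
  sum_nonneg fun m _ => hν.1 (m, a)

lemma isProb_obsMarg {M P O : Type*} [Fintype M] [Fintype P] [Fintype O]
    {Mo : M → P → O → ℝ} (hMo : ∀ m π, IsProb (Mo m π)) {ν : M × P → ℝ} (hν : IsProb ν) (b : P) :
    IsProb (obsMarg Mo ν b) := by
  refine ⟨fun o => sum_nonneg fun x _ => mul_nonneg (hν.1 x) ((hMo _ _).1 o), ?_⟩
  unfold obsMarg
  rw [sum_comm]
  simp_rw [← mul_sum, (hMo _ _).2, mul_one, hν.2]

lemma isProb_obsCond {M P O : Type*} [Fintype M] [Fintype P] [Fintype O]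
    {Mo : M → P → O → ℝ} (hMo : ∀ m π, IsProb (Mo m π)) {ν : M × P → ℝ} (hν : IsProb ν)
    {a : P} (ha : 0 < margPi ν a) (b : P) : IsProb (obsCond Mo ν a b) := by
  refine ⟨fun o => div_nonneg
    (sum_nonneg fun m _ => mul_nonneg (hν.1 _) ((hMo _ _).1 o)) ha.le, ?_⟩
  unfold obsCond
  rw [← sum_div, sum_comm]
  simp_rw [← mul_sum, (hMo _ _).2, mul_one]
  exact div_self ha.ne'

lemma margPi_mul_obsCond {M P O : Type*} [Fintype M] [Fintype P] [Fintype O]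
    (Mo : M → P → O → ℝ) {ν : M × P → ℝ} (hν : IsProb ν) (a b : P) (o : O) :
    margPi ν a * obsCond Mo ν a b o = ∑ m, ν (m, a) * Mo m b o := by
  unfold obsCond
  rcases eq_or_ne (margPi ν a) 0 with h | h
  · have hzero : ∀ m, ν (m, a) = 0 := fun m =>
      (sum_eq_zero_iff_of_nonneg fun m _ => hν.1 (m, a)).1 h m (mem_univ m)
    simp [h, hzero]
  · exact mul_div_cancel₀ _ h

/-- The expected regret of Thompson sampling is the average over `π*` of the gap between the
conditional and the marginal mean observation of `π*`. -/
lemma thompson_regret_eq {M P O : Type*} [Fintype M] [Fintype P] [Fintype O]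
    (Mo : M → P → O → ℝ) (r : O → ℝ) {ν : M × P → ℝ} (hν : IsProb ν) :
    (∑ x : M × P, ν x * ∑ o, r o * Mo x.1 x.2 o)
        - ∑ x : M × P, ∑ π, ν x * margPi ν π * ∑ o, r o * Mo x.1 π o
      = ∑ a, margPi ν a * (∑ o, r o * obsCond Mo ν a a o - ∑ o, r o * obsMarg Mo ν a o) := by
  simp_rw [mul_sub, sum_sub_distrib]
  congr 1
  · rw [Fintype.sum_prod_type_right]
    refine sum_congr rfl fun a _ => ?_
    simp_rw [mul_sum, mul_left_comm (margPi ν a), margPi_mul_obsCond Mo hν, mul_sum]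
    rw [sum_comm]
    exact sum_congr rfl fun o _ => sum_congr rfl fun m _ => by ring
  · rw [sum_comm]
    refine sum_congr rfl fun a _ => ?_
    simp_rw [obsMarg, mul_sum]
    rw [sum_comm]
    exact sum_congr rfl fun o _ => sum_congr rfl fun x _ => by ring

/-- Information ratio of Thompson sampling for `K`-armed bandits (squared Hellinger
form): for bandits with decisions `Fin K`, observations a finite subset of `[0,1]`
(rewards), and mean rewards `f_M(π) = Σ_o o·[M(π)](o)`, the squared expected
Thompson-sampling regret is at most `4K` times the Hellinger information gain. -/
theorem ts_information_ratio_K_armed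
    (K : ℕ) (hK : 0 < K) {M : Type*} [Fintype M] [Nonempty M]
    (Obs : Finset ℝ) (hObsne : Obs.Nonempty)
    (hObs01 : ∀ o ∈ Obs, (0 : ℝ) ≤ o ∧ o ≤ 1)
    (Mo : M → Fin K → {o // o ∈ Obs} → ℝ)
    (hMo : ∀ m π, IsProb (Mo m π))
    (ν : M × Fin K → ℝ) (hν : IsProb ν) :
    ((∑ x : M × Fin K, ν x * ∑ o : {o // o ∈ Obs}, (o : ℝ) * Mo x.1 x.2 o)
        - ∑ x : M × Fin K, ∑ π, ν x * margPi ν π * ∑ o : {o // o ∈ Obs}, (o : ℝ) * Mo x.1 π o) ^ 2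
      ≤ 4 * K * ∑ πs, ∑ π, (if 0 < margPi ν πs then
          margPi ν πs * margPi ν π * Hsq (obsCond Mo ν πs π) (obsMarg Mo ν π) else 0) := by
  rw [thompson_regret_eq Mo (fun o => (o : ℝ)) hν]
  refine sq_sum_le_card_mul_sum_sq.trans ?_
  rw [card_univ, Fintype.card_fin, mul_comm (4 : ℝ), mul_assoc]
  refine mul_le_mul_of_nonneg_left ?_ K.cast_nonneg
  rw [mul_sum]
  refine sum_le_sum fun a _ => ?_
  rcases (margPi_nonneg hν a).eq_or_lt with ha | ha
  · simp [← ha]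
  simp only [ha, if_true]
  have hterm : ∀ b, 0 ≤ margPi ν a * margPi ν b * Hsq (obsCond Mo ν a b) (obsMarg Mo ν b) :=
    fun b => mul_nonneg (mul_nonneg ha.le (margPi_nonneg hν b))
      (sum_nonneg fun _ _ => sq_nonneg _)
  have hdiag := single_le_sum (fun b _ => hterm b) (mem_univ a)
  have hgap := sq_mean_sub_le_Hsq (r := fun o : {o // o ∈ Obs} => (o : ℝ))
    (isProb_obsCond hMo hν ha a) (isProb_obsMarg hMo hν a) fun o => hObs01 o o.2
  calc _ ≤ margPi ν a ^ 2 * (4 * Hsq (obsCond Mo ν a a) (obsMarg Mo ν a)) := by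
        rw [mul_pow]
        exact mul_le_mul_of_nonneg_left hgap (sq_nonneg _)
    _ ≤ _ := by linarith
end

section
/- Boundedness of the derivatives of AIR with respect to the marginal belief (log-partition form): let K ≥ 1, η > 0, let p ∈ Δ({1,…,K}) have p(j) > 0 for all j, and let g_1,…,g_K and g_avg be real-valued functions on {1,…,K} satisfying g_i(j) − g_avg(j) = η·1[i=j]/p(j) − η for all i, j ∈ {1,…,K}. Then for every i ∈ {1,…,K}: −η ≤ Σ_{j=1}^K p(j)·( log(1+e^{g_i(j)}) − log(1+e^{g_avg(j)}) ) ≤ η. -/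
open Finset

/-- The softplus function `x ↦ log (1 + exp x)` is nondecreasing and 1-Lipschitz. -/
theorem log_one_add_exp_le_add {x y c : ℝ} (hc : 0 ≤ c) (h : y ≤ x + c) :
    Real.log (1 + Real.exp y) ≤ Real.log (1 + Real.exp x) + c := by
  have hx : 0 < 1 + Real.exp x := by positivity
  rw [← Real.log_exp c, ← Real.log_mul hx.ne' (Real.exp_pos c).ne']
  apply Real.log_le_log (by positivity)
  have hy : Real.exp y ≤ Real.exp x * Real.exp c := by
    rw [← Real.exp_add]
    exact Real.exp_le_exp.mpr h
  linarith [Real.one_le_exp hc]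

/-- Boundedness of the derivatives of AIR with respect to the marginal belief
(log-partition form): if `g_i(j) − g_avg(j) = η·1[i=j]/p(j) − η` for all `i,j`,
then for every `i`,
`−η ≤ Σ_j p(j)·(log(1+e^{g_i(j)}) − log(1+e^{g_avg(j)})) ≤ η`. -/
theorem boundedness_of_derivatives (K : ℕ) (hK : 1 ≤ K) (η : ℝ) (hη : 0 < η)
    (p : Fin K → ℝ) (hp : IsProb p) (hppos : ∀ j, 0 < p j)
    (g : Fin K → Fin K → ℝ) (gavg : Fin K → ℝ)
    (hg : ∀ i j, g i j - gavg j = η * (if i = j then (1 : ℝ) else 0) / p j - η) :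
    ∀ i : Fin K,
      -η ≤ ∑ j, p j * (Real.log (1 + Real.exp (g i j)) - Real.log (1 + Real.exp (gavg j))) ∧
      ∑ j, p j * (Real.log (1 + Real.exp (g i j)) - Real.log (1 + Real.exp (gavg j))) ≤ η := by
  intro i
  constructor
  · calc -η = ∑ j, p j * -η := by rw [← Finset.sum_mul, hp.2, one_mul]
      _ ≤ _ := by
        refine Finset.sum_le_sum fun j _ => mul_le_mul_of_nonneg_left ?_ (hp.1 j)
        have hd : 0 ≤ η * (if i = j then (1 : ℝ) else 0) / p j :=
          div_nonneg (mul_nonneg hη.le (by split_ifs <;> norm_num)) (hp.1 j)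
        have hle : gavg j ≤ g i j + η := by linarith [hg i j]
        linarith [log_one_add_exp_le_add hη.le hle]
  · calc _ ≤ ∑ j, η * (if i = j then (1 : ℝ) else 0) := by
          refine Finset.sum_le_sum fun j _ => ?_
          have hd : 0 ≤ η * (if i = j then (1 : ℝ) else 0) / p j :=
            div_nonneg (mul_nonneg hη.le (by split_ifs <;> norm_num)) (hp.1 j)
          have hle : g i j ≤ gavg j + η * (if i = j then (1 : ℝ) else 0) / p j := by
            linarith [hg i j]
          rw [mul_comm, ← le_div_iff₀ (hppos j)]
          linarith [log_one_add_exp_le_add hd hle]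
      _ = η := by simp
end

section
/- Drifted error bound using KL divergence: let S be a finite nonempty set, let p, q ∈ Δ(S) with q(x) > 0 for all x, let η > 0, and let y : S → ℝ satisfy y(x) ≤ 1/η for all x ∈ S. Then Σ_x y(x)·( p(x) − q(x) ) − (1/η)·KL(p,q) ≤ η·Σ_x q(x)·y(x)². -/
open Finset

/-- The quadratic upper bound for the exponential, valid on `(-∞, 1]`. -/
theorem exp_le_one_add_add_sq {z : ℝ} (hz : z ≤ 1) : Real.exp z ≤ 1 + z + z ^ 2 := by
  rcases le_total (-1) z with h | h
  · have := (abs_le.mp (Real.abs_exp_sub_one_sub_id_le (abs_le.mpr ⟨h, hz⟩))).2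
    linarith
  · have : Real.exp z ≤ 1 := Real.exp_le_one_iff.mpr (by linarith)
    nlinarith

/-- The Fenchel–Young inequality for the relative entropy. -/
theorem mul_sub_mul_log_div_le {a b : ℝ} (ha : 0 ≤ a) (hb : 0 < b) (z : ℝ) :
    z * a - a * Real.log (a / b) ≤ b * Real.exp z - a := by
  rcases ha.eq_or_lt with rfl | ha
  · have := mul_pos hb (Real.exp_pos z)
    simpa using this.le
  · have h := mul_le_mul_of_nonneg_left (Real.add_one_le_exp (z - Real.log (a / b))) ha.le
    rw [Real.exp_sub, Real.exp_log (div_pos ha hb)] at h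
    have e : a * (Real.exp z / (a / b)) = b * Real.exp z := by field_simp
    rw [e] at h
    linarith

/-- Drifted error bound using KL divergence. -/
theorem drifted_error_bound {S : Type*} [Fintype S] [Nonempty S]
    (p q : S → ℝ) (hp : IsProb p) (hq : IsProb q) (hqpos : ∀ x, 0 < q x)
    (η : ℝ) (hη : 0 < η) (y : S → ℝ) (hy : ∀ x, y x ≤ 1 / η) :
    ∑ x, y x * (p x - q x) - (1 / η) * KLr p q ≤ η * ∑ x, q x * (y x) ^ 2 := by
  have key : ∀ x, y x * (p x - q x) - (1 / η) * (p x * Real.log (p x / q x)) ≤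
      η * (q x * y x ^ 2) + (1 / η) * (q x - p x) := by
    intro x
    have hz : η * y x ≤ 1 := by
      have := mul_le_mul_of_nonneg_left (hy x) hη.le
      rwa [mul_one_div_cancel hη.ne'] at this
    have h1 := mul_sub_mul_log_div_le (hp.1 x) (hqpos x) (η * y x)
    have h2 := mul_le_mul_of_nonneg_left (exp_le_one_add_add_sq hz) (hqpos x).le
    refine le_of_mul_le_mul_left ?_ hη
    have e1 : η * (y x * (p x - q x) - (1 / η) * (p x * Real.log (p x / q x))) =
        η * y x * (p x - q x) - p x * Real.log (p x / q x) := by field_simp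
    have e2 : η * (η * (q x * y x ^ 2) + (1 / η) * (q x - p x)) =
        q x * (η * y x) ^ 2 + (q x - p x) := by field_simp
    rw [e1, e2]
    linarith
  have h := Finset.sum_le_sum fun x (_ : x ∈ Finset.univ) => key x
  rw [Finset.sum_sub_distrib, Finset.sum_add_distrib, ← Finset.mul_sum, ← Finset.mul_sum,
    ← Finset.mul_sum, Finset.sum_sub_distrib (f := q), hp.2, hq.2] at h
  simpa [KLr] using h
end

section
/- Multiplicative Pinsker-type inequality for the Hellinger distance: for any finite set S, any R ≥ 0, any p, q ∈ Δ(S), and any h : S → [0,R], | Σ_x h(x)·p(x) − Σ_x h(x)·q(x) | ≤ √( 2R·( Σ_x h(x)·p(x) + Σ_x h(x)·q(x) )·D_H²(p,q) ). -/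
open Finset

/-- Multiplicative Pinsker-type inequality for the Hellinger distance:
for `h : S → [0,R]`,
`|E_p[h] − E_q[h]| ≤ √(2R·(E_p[h] + E_q[h])·D_H²(p,q))`. -/
theorem multiplicative_pinsker_hellinger {S : Type*} [Fintype S]
    (R : ℝ) (hR : 0 ≤ R) (p q : S → ℝ) (hp : IsProb p) (hq : IsProb q)
    (h : S → ℝ) (hh : ∀ x, 0 ≤ h x ∧ h x ≤ R) :
    |∑ x, h x * p x - ∑ x, h x * q x|
      ≤ Real.sqrt (2 * R * ((∑ x, h x * p x) + ∑ x, h x * q x) * Hsq p q) := by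
  have sq_p (x : S) : √(p x) ^ 2 = p x := Real.sq_sqrt (hp.1 x)
  have sq_q (x : S) : √(q x) ^ 2 = q x := Real.sq_sqrt (hq.1 x)
  apply Real.abs_le_sqrt
  have factor : ∑ x, h x * p x - ∑ x, h x * q x
      = ∑ x, h x * (√(p x) + √(q x)) * (√(p x) - √(q x)) := by
    rw [← Finset.sum_sub_distrib]
    refine Finset.sum_congr rfl fun x _ => ?_
    linear_combination h x * sq_q x - h x * sq_p x
  have weight_le : ∑ x, (h x * (√(p x) + √(q x))) ^ 2
      ≤ 2 * R * ((∑ x, h x * p x) + ∑ x, h x * q x) := by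
    rw [← Finset.sum_add_distrib, Finset.mul_sum]
    refine Finset.sum_le_sum fun x _ => ?_
    obtain ⟨h_nonneg, h_le⟩ := hh x
    calc (h x * (√(p x) + √(q x))) ^ 2 = h x * h x * (√(p x) + √(q x)) ^ 2 := by ring
      _ ≤ R * h x * (2 * (√(p x) ^ 2 + √(q x) ^ 2)) := by
        gcongr
        exact add_sq_le
      _ = 2 * R * (h x * p x + h x * q x) := by
        rw [sq_p, sq_q]
        ring
  rw [factor]
  refine (Finset.sum_mul_sq_le_sq_mul_sq _ _ _).trans ?_
  exact mul_le_mul_of_nonneg_right weight_le (Finset.sum_nonneg fun x _ => sq_nonneg _)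
end
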